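/- Let Q be a prime power, F_Q the finite field with Q elements of characteristic p, and r a positive integer with p ∤ (r + 2). Define g(x, m) = x^{r+2} + Σ_{i=1}^{r} m_{i−1} x^i for m ∈ F_Q^r and x ∈ F_Q. Fix m ∈ F_Q^r and fix L − 1 nonzero manipulations δ_j = (Δm_j, Δx_j, Δt_j) ∈ F_Q^r × F_Q × F_Q for j = 2, …, L (each δ_j ≠ (0,0,0)). Then the number of x ∈ F_Q for which there exists some j with g(x + Δx_j, m + Δm_j) = g(x, m) + Δt_j is at most (L − 1)(r + 1); equivalently, a uniformly random x ∈ F_Q satisfies none of these equations with probability at least 1 − (L − 1)(r + 1)/Q. -/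

import Mathlib

/-- The AMD tag function `g(x, m) = x^{r+2} + ∑_{i=1}^{r} m_{i-1} x^i`. -/
def amdTag {F : Type*} [Field F] (r : ℕ) (x : F) (m : Fin r → F) : F :=
  x ^ (r + 2) + ∑ i : Fin r, m i * x ^ ((i : ℕ) + 1)

open Polynomial in
/-- The tag `amdTag r y m` as a polynomial in the variable, evaluated at `y = X + a`. -/
noncomputable def amdTagPoly {F : Type*} [Field F] (r : ℕ) (a : F) (m : Fin r → F) : F[X] :=
  (X + C a) ^ (r + 2) + ∑ i : Fin r, C (m i) * (X + C a) ^ ((i : ℕ) + 1)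

open Polynomial in
theorem eval_amdTagPoly {F : Type*} [Field F] (r : ℕ) (a : F) (m : Fin r → F) (x : F) :
    (amdTagPoly r a m).eval x = amdTag r (x + a) m := by
  simp [amdTagPoly, amdTag, eval_finsetSum]

open Polynomial in
theorem coeff_amdTagPoly_of_lt {F : Type*} [Field F] (r : ℕ) (a : F) (m : Fin r → F) {k : ℕ}
    (hk : r < k) : (amdTagPoly r a m).coeff k = a ^ (r + 2 - k) * ((r + 2).choose k : F) := by
  have hsum : ∑ i : Fin r, (C (m i) * (X + C a) ^ ((i : ℕ) + 1)).coeff k = 0 := by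
    refine Finset.sum_eq_zero fun i _ => ?_
    rw [coeff_C_mul, coeff_X_add_C_pow, Nat.choose_eq_zero_of_lt (by omega)]
    simp
  rw [amdTagPoly, coeff_add, finsetSum_coeff, hsum, coeff_X_add_C_pow, add_zero]

open Polynomial in
theorem coeff_amdTagPoly_zero {F : Type*} [Field F] (r : ℕ) (m : Fin r → F) (i : Fin r) :
    (amdTagPoly r 0 m).coeff ((i : ℕ) + 1) = m i := by
  have hr : (i : ℕ) ≠ r + 1 := by omega
  simp [amdTagPoly, coeff_X_pow, Fin.val_inj, hr]

open Polynomial in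
theorem card_amdTag_eq_le {F : Type*} [Field F] [Fintype F] [DecidableEq F]
    (p : ℕ) [CharP F p] (r : ℕ) (hpr : ¬ p ∣ (r + 2)) (m d : Fin r → F) (a t : F)
    (hδ : ¬ (d = 0 ∧ a = 0 ∧ t = 0)) :
    (Finset.univ.filter fun x : F =>
      amdTag r (x + a) (fun i => m i + d i) = amdTag r x m + t).card ≤ r + 1 := by
  set P : F[X] := amdTagPoly r a (fun i => m i + d i) - amdTagPoly r 0 m - C t with hP
  have hdeg : P.natDegree ≤ r + 1 := by
    refine natDegree_le_iff_coeff_eq_zero.2 fun k hk => ?_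
    rw [hP, coeff_sub, coeff_sub, coeff_amdTagPoly_of_lt _ _ _ (by omega),
      coeff_amdTagPoly_of_lt _ _ _ (by omega), coeff_C_of_ne_zero (by omega),
      Nat.sub_eq_zero_of_le (show r + 2 ≤ k by omega)]
    simp
  have hne : P ≠ 0 := by
    intro h0
    have hc : ∀ k, P.coeff k = 0 := fun k => by rw [h0, coeff_zero]
    have ha : a = 0 := by
      have h := hc (r + 1)
      rw [hP, coeff_sub, coeff_sub, coeff_amdTagPoly_of_lt _ _ _ (by omega),
        coeff_amdTagPoly_of_lt _ _ _ (by omega), coeff_C_of_ne_zero (by omega),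
        show r + 2 - (r + 1) = 1 by omega, Nat.choose_succ_self_right] at h
      have hr2 : ((r + 1 + 1 : ℕ) : F) ≠ 0 := fun h => hpr ((CharP.cast_eq_zero_iff F p _).1 h)
      simpa only [pow_one, zero_mul, sub_zero, mul_eq_zero, hr2, or_false] using h
    subst ha
    refine hδ ⟨funext fun i => ?_, rfl, ?_⟩
    · have h := hc ((i : ℕ) + 1)
      rw [hP, coeff_sub, coeff_sub, coeff_amdTagPoly_zero, coeff_amdTagPoly_zero,
        coeff_C_of_ne_zero (by omega)] at h
      simpa using h
    · have h := hc 0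
      rw [coeff_zero_eq_eval_zero, hP, eval_sub, eval_sub, eval_amdTagPoly,
        eval_amdTagPoly] at h
      simpa [amdTag] using h
  calc _ ≤ P.roots.toFinset.card := by
        refine Finset.card_le_card fun x hx => ?_
        rw [Finset.mem_filter_univ] at hx
        rw [Multiset.mem_toFinset, mem_roots hne, IsRoot.def, hP, eval_sub, eval_sub,
          eval_amdTagPoly, eval_amdTagPoly, hx, add_zero, eval_C]
        ring
    _ ≤ P.roots.card := Multiset.toFinset_card_le _
    _ ≤ P.natDegree := card_roots' P
    _ ≤ r + 1 := hdeg

/-- with `p ∤ r + 2`, for a fixed message `m` and `L - 1` fixed nonzero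
manipulations `δ_j = (Δm_j, Δx_j, Δt_j)`, at most `(L - 1)(r + 1)` elements `x ∈ F_Q`
satisfy some manipulated equation; equivalently a uniformly random `x` satisfies none of
them with probability at least `1 - (L - 1)(r + 1)/Q`. -/
theorem amd_union_bound {F : Type*} [Field F] [Fintype F] [DecidableEq F]
    (p : ℕ) [CharP F p] (r : ℕ) (hr : 0 < r) (hpr : ¬ p ∣ (r + 2))
    (m : Fin r → F) (L : ℕ) (hL : 1 ≤ L)
    (Δm : Fin (L - 1) → Fin r → F) (Δx Δt : Fin (L - 1) → F)
    (hδ : ∀ j, ¬ (Δm j = 0 ∧ Δx j = 0 ∧ Δt j = 0)) :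
    (Finset.univ.filter fun x : F => ∃ j : Fin (L - 1),
        amdTag r (x + Δx j) (fun i => m i + Δm j i) = amdTag r x m + Δt j).card
      ≤ (L - 1) * (r + 1) ∧
    (1 : ℝ) - (((L - 1) * (r + 1) : ℕ) : ℝ) / (Fintype.card F : ℝ) ≤
      ((Finset.univ.filter fun x : F => ∀ j : Fin (L - 1),
          amdTag r (x + Δx j) (fun i => m i + Δm j i) ≠ amdTag r x m + Δt j).card : ℝ) /
        (Fintype.card F : ℝ) := by
  have hcard : (Finset.univ.filter fun x : F => ∃ j : Fin (L - 1),
      amdTag r (x + Δx j) (fun i => m i + Δm j i) = amdTag r x m + Δt j).card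
      ≤ (L - 1) * (r + 1) := by
    rw [show (Finset.univ.filter fun x : F => ∃ j : Fin (L - 1),
        amdTag r (x + Δx j) (fun i => m i + Δm j i) = amdTag r x m + Δt j) =
        Finset.univ.biUnion fun j : Fin (L - 1) => Finset.univ.filter fun x : F =>
          amdTag r (x + Δx j) (fun i => m i + Δm j i) = amdTag r x m + Δt j by ext x; simp]
    simpa using Finset.card_biUnion_le_card_mul Finset.univ _ (r + 1) fun j _ =>
      card_amdTag_eq_le p r hpr m (Δm j) (Δx j) (Δt j) (hδ j)
  refine ⟨hcard, ?_⟩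
  have hQ : (0 : ℝ) < Fintype.card F := by exact_mod_cast Fintype.card_pos
  have hsplit := Finset.card_filter_add_card_filter_not (s := Finset.univ) fun x : F =>
    ∃ j : Fin (L - 1), amdTag r (x + Δx j) (fun i => m i + Δm j i) = amdTag r x m + Δt j
  simp only [not_exists, Finset.card_univ] at hsplit
  rw [one_sub_div hQ.ne', div_le_div_iff_of_pos_right hQ, sub_le_iff_le_add]
  have hle := hsplit.symm.le.trans (Nat.add_le_add_right hcard _)
  rw [add_comm] at hle
  exact_mod_cast hle
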